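/- Mass constraint for leakage-free selectors: suppose the feature distribution supports the Cartesian product of possible feature values and ζ is a feature selector without leakage. Then for every mask h, every index i with h[i] = 0, and all x, x' with p(x) > 0, p(x') > 0 and x⊙h = x'⊙h, it holds that ζ(h^{+i} | x) + Σ_{h' ∈ excluded(h,i)} ζ(h' | x') ≤ 1, where h^{+i} is the mask obtained from h by additionally setting entry i to 1, and excluded(h, i) = { h' ∈ {0,1}^d : h'[i] = 0 and h'[j] = 1 for every j with h[j] = 1 }. -/

import Mathlib

open Finset

noncomputable section

/-- A feature mask over `d` features: `true` means the feature is selected. -/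
abbrev Mask (d : ℕ) := Fin d → Bool

variable {d : ℕ} {V : Fin d → Type*} {Y : Type*}

/-- The masked feature vector `x ⊙ h`: selected features keep their value,
non-selected features are replaced by the masking symbol `none` (∅). -/
def applyMask (x : ∀ i, V i) (h : Mask d) : ∀ i, Option (V i) :=
  fun i => if h i then some (x i) else none

/-- The number of selected features `‖h‖₀`, as a real number. -/
def maskSize {d : ℕ} (h : Mask d) : ℝ :=
  ((Finset.univ.filter fun i => h i = true).card : ℝ)

section Leakage

variable [∀ i, Fintype (V i)] [∀ i, DecidableEq (V i)] [∀ i, Nonempty (V i)]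
  [Fintype Y] [DecidableEq Y]

variable (p : (∀ i, V i) → Y → ℝ) (ζ : (∀ i, V i) → Mask d → ℝ)

/-- Marginal probability `p(x)`. -/
def pX (x : ∀ i, V i) : ℝ := ∑ y, p x y

/-- `p` is a probability distribution on `X × Y`. -/
def IsDist : Prop := (∀ x y, 0 ≤ p x y) ∧ (∑ x, ∑ y, p x y) = 1

/-- `ζ` is a feature selector: for every `x` with `p(x) > 0`, `ζ(·|x)` is a
probability distribution over masks. -/
def IsSelector : Prop :=
  (∀ x h, 0 ≤ ζ x h) ∧ ∀ x, 0 < pX p x → (∑ h : Mask d, ζ x h) = 1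

/-- `p(x[s^in])`: probability that the features selected by `h` take the values `x[s^in]`. -/
def pIn (h : Mask d) (x : ∀ i, V i) : ℝ :=
  ∑ x' ∈ univ.filter (fun x' => applyMask x' h = applyMask x h), pX p x'

/-- `p(x[s^in], y)`. -/
def pInY (h : Mask d) (x : ∀ i, V i) (y : Y) : ℝ :=
  ∑ x' ∈ univ.filter (fun x' => applyMask x' h = applyMask x h), p x' y

/-- `p(x[s^in], h[s^in]=1, h[s^ex]=0)` under the joint distribution `p(x,y)·ζ(h|x)`. -/
def pInSel (h : Mask d) (x : ∀ i, V i) : ℝ :=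
  ∑ x' ∈ univ.filter (fun x' => applyMask x' h = applyMask x h), pX p x' * ζ x' h

/-- `p(x[s^in], y, h[s^in]=1, h[s^ex]=0)`. -/
def pInYSel (h : Mask d) (x : ∀ i, V i) (y : Y) : ℝ :=
  ∑ x' ∈ univ.filter (fun x' => applyMask x' h = applyMask x h), p x' y * ζ x' h

/-- `p(y | x[s^in])`. -/
def condLabel (h : Mask d) (x : ∀ i, V i) (y : Y) : ℝ := pInY p h x y / pIn p h x

/-- `p(y | x[s^in], h[s^in]=1, h[s^ex]=0)`. -/
def condLabelSel (h : Mask d) (x : ∀ i, V i) (y : Y) : ℝ :=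
  pInYSel p ζ h x y / pInSel p ζ h x

/-- `p(x[s^ex] | x[s^in])`. -/
def condFeat (h : Mask d) (x : ∀ i, V i) : ℝ := pX p x / pIn p h x

/-- `p(x[s^ex] | x[s^in], h[s^in]=1, h[s^ex]=0)`. -/
def condFeatSel (h : Mask d) (x : ∀ i, V i) : ℝ :=
  (pX p x * ζ x h) / pInSel p ζ h x

/-- `p(h[s^in]=1, h[s^ex]=0 | x[s^in])`. -/
def condSel (h : Mask d) (x : ∀ i, V i) : ℝ := pInSel p ζ h x / pIn p h x

/-- `p(h[s^in]=1, h[s^ex]=0 | x[s^in], y)`. -/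
def condSelY (h : Mask d) (x : ∀ i, V i) (y : Y) : ℝ :=
  pInYSel p ζ h x y / pInY p h x y

/-- `p(h[s^in]=1, h[s^ex]=0 | x[s^in], x[s^ex])`. -/
def condSelX (h : Mask d) (x : ∀ i, V i) : ℝ := (pX p x * ζ x h) / pX p x

/-- `p(h[s^in]=1, h[s^ex]=0 | x[s^in], x[s^ex], y)`. -/
def condSelXY (h : Mask d) (x : ∀ i, V i) (y : Y) : ℝ := (p x y * ζ x h) / (p x y)

/-- `(x, y, s^in, s^ex) ∈ Ω`, where `s^in`/`s^ex` are the sets of features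
selected/not selected by the mask `h`. -/
def InOmega (h : Mask d) (x : ∀ i, V i) (y : Y) : Prop :=
  0 < pX p x ∧ 0 < ζ x h ∧ 0 < pInY p h x y

/-- `ζ` has no label leakage: conditioning the label distribution on the
selection of features by `ζ` does not change the label distribution. -/
def NoLabelLeakage : Prop :=
  ∀ (h : Mask d) (x : ∀ i, V i) (y : Y), InOmega p ζ h x y →
    condLabel p h x y = condLabelSel p ζ h x y

/-- `ζ` has no feature leakage: conditioning the feature distribution on the
selection of features by `ζ` does not change the feature distribution. -/
def NoFeatureLeakage : Prop :=
  ∀ (h : Mask d) (x : ∀ i, V i) (y : Y), InOmega p ζ h x y →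
    condFeat p h x = condFeatSel p ζ h x

/-- The feature distribution supports the Cartesian product of possible feature
values: if every coordinate value `a i` has positive marginal probability, then
the full assignment `a` has positive probability. -/
def FullSupport : Prop :=
  ∀ a : ∀ i, V i,
    (∀ i : Fin d, 0 < ∑ x ∈ univ.filter (fun x : ∀ i, V i => x i = a i), pX p x) →
    0 < pX p a

/-- `h^{+i}`: the mask obtained from `h` by additionally setting entry `i` to 1. -/
def plusMask {d : ℕ} (h : Mask d) (i : Fin d) : Mask d := fun j => h j || decide (j = i)

/-- `excluded(h, i)`: the masks `h'` with `h'[i] = 0` that select every feature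
selected by `h`. -/
def excludedSet {d : ℕ} (h : Mask d) (i : Fin d) : Finset (Mask d) :=
  univ.filter (fun h' => h' i = false ∧ ∀ j, h j = true → h' j = true)

set_option linter.unusedSectionVars false

/-- Two feature vectors agree after masking iff they agree on the selected features. -/
lemma applyMask_eq_iff {x z : ∀ i, V i} {h : Mask d} :
    applyMask x h = applyMask z h ↔ ∀ j, h j = true → x j = z j := by
  constructor
  · intro hxz j hj
    simpa [applyMask, hj] using congrFun hxz j
  · intro hxz
    funext j
    by_cases hj : h j = true
    · simp [applyMask, hj, hxz j hj]
    · simp [applyMask, hj]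

lemma pX_nonneg (hp : IsDist p) (x : ∀ i, V i) : 0 ≤ pX p x :=
  sum_nonneg fun y _ => hp.1 x y

lemma exists_pInY_pos (hp : IsDist p) {x : ∀ i, V i} (hx : 0 < pX p x) (g : Mask d) :
    ∃ y, 0 < pInY p g x y := by
  obtain ⟨y, -, hy⟩ := (sum_pos_iff_of_nonneg fun y _ => hp.1 x y).mp hx
  exact ⟨y, sum_pos' (fun z _ => hp.1 z y) ⟨x, by simp, hy⟩⟩

/-- Without feature leakage, the probability of a mask that `x` may receive equals its
conditional probability given the selected features. -/
lemma pInSel_eq_pIn_mul (hp : IsDist p) (hζ : IsSelector p ζ) (hnfl : NoFeatureLeakage p ζ)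
    {g : Mask d} {x : ∀ i, V i} (hx : 0 < pX p x) (hg : 0 < ζ x g) :
    pInSel p ζ g x = pIn p g x * ζ x g := by
  obtain ⟨y, hy⟩ := exists_pInY_pos p hp hx g
  have hIn : 0 < pIn p g x := sum_pos' (fun z _ => pX_nonneg p hp z) ⟨x, by simp, hx⟩
  have hSel : 0 < pInSel p ζ g x :=
    sum_pos' (fun z _ => mul_nonneg (pX_nonneg p hp z) (hζ.1 z g))
      ⟨x, by simp, mul_pos hx hg⟩
  have hfeat := hnfl g x y ⟨hx, hg, hy⟩
  rw [condFeat, condFeatSel, div_eq_div_iff hIn.ne' hSel.ne'] at hfeat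
  exact mul_left_cancel₀ hx.ne' (by linarith)

/-- Without feature leakage, a mask has the same probability at any two feature vectors of
positive probability that agree on the features it selects, provided it is possible at one. -/
lemma selector_eq_of_pos (hp : IsDist p) (hζ : IsSelector p ζ) (hnfl : NoFeatureLeakage p ζ)
    {g : Mask d} {x z : ∀ i, V i} (hx : 0 < pX p x) (hz : 0 < pX p z)
    (hxz : applyMask x g = applyMask z g) (hg : 0 < ζ x g) : ζ z g = ζ x g := by
  have hsel := pInSel_eq_pIn_mul p ζ hp hζ hnfl hx hg
  have hle : ∀ w ∈ univ.filter (fun w => applyMask w g = applyMask x g),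
      pX p w * ζ w g ≤ pX p w * ζ x g := by
    intro w hw
    have hwx : applyMask w g = applyMask x g := (mem_filter.mp hw).2
    rcases (pX_nonneg p hp w).eq_or_lt with hw0 | hw0
    · simp [← hw0]
    · rcases (hζ.1 w g).eq_or_lt with hwg | hwg
      · rw [← hwg, mul_zero]
        positivity
      · have hIn : 0 < pIn p g x := sum_pos' (fun v _ => pX_nonneg p hp v) ⟨x, by simp, hx⟩
        have hselw := pInSel_eq_pIn_mul p ζ hp hζ hnfl hw0 hwg
        simp only [pInSel, pIn, hwx] at hselw hsel hIn
        rw [mul_left_cancel₀ hIn.ne' (hselw.symm.trans hsel)]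
  have heq := (sum_eq_sum_iff_of_le hle).mp (by rw [← sum_mul]; exact hsel)
  exact mul_left_cancel₀ hz.ne' (heq z (by simp [hxz]))

/-- Without feature leakage, the probability of a mask depends only on the features it
selects. -/
lemma selector_eq_of_applyMask_eq (hp : IsDist p) (hζ : IsSelector p ζ)
    (hnfl : NoFeatureLeakage p ζ) {g : Mask d} {x z : ∀ i, V i} (hx : 0 < pX p x)
    (hz : 0 < pX p z) (hxz : applyMask x g = applyMask z g) : ζ x g = ζ z g := by
  rcases (hζ.1 x g).eq_or_lt with hxg | hxg
  · rcases (hζ.1 z g).eq_or_lt with hzg | hzg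
    · rw [← hxg, ← hzg]
    · exact selector_eq_of_pos p ζ hp hζ hnfl hz hx hxz.symm hzg
  · exact (selector_eq_of_pos p ζ hp hζ hnfl hx hz hxz hxg).symm

/-- Under full support, replacing one feature value by another possible one keeps the
probability positive. -/
lemma pX_update_pos (hp : IsDist p) (hsupp : FullSupport p) {x z : ∀ i, V i}
    (hx : 0 < pX p x) (hz : 0 < pX p z) (i : Fin d) :
    0 < pX p (Function.update z i (x i)) := by
  refine hsupp _ fun j => ?_
  by_cases hj : j = i
  · subst hj
    exact sum_pos' (fun w _ => pX_nonneg p hp w) ⟨x, by simp, hx⟩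
  · exact sum_pos' (fun w _ => pX_nonneg p hp w) ⟨z, by simp [hj], hz⟩

/-- mass constraint for leakage-free selectors: under full
Cartesian-product support, for every mask `h`, every index `i` not selected by
`h`, and all positive-probability `x, x'` with `x⊙h = x'⊙h`, the probability of
`h^{+i}` at `x` plus the total probability of `excluded(h,i)` at `x'` is at
most one. -/
theorem mass_constraint_no_leakage
    (hp : IsDist p) (hζ : IsSelector p ζ) (hsupp : FullSupport p)
    (hnll : NoLabelLeakage p ζ) (hnfl : NoFeatureLeakage p ζ)
    (h : Mask d) (i : Fin d) (hi : h i = false)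
    (x x' : ∀ i, V i) (hx : 0 < pX p x) (hx' : 0 < pX p x')
    (hagree : applyMask x h = applyMask x' h) :
    ζ x (plusMask h i) + ∑ h' ∈ excludedSet h i, ζ x' h' ≤ 1 := by
  set z := Function.update x' i (x i) with hzdef
  have hz : 0 < pX p z := pX_update_pos p hp hsupp hx hx' i
  have hplus : ζ x (plusMask h i) = ζ z (plusMask h i) := by
    refine selector_eq_of_applyMask_eq p ζ hp hζ hnfl hx hz (applyMask_eq_iff.mpr ?_)
    intro j hj
    by_cases hji : j = i
    · subst hji
      simp [hzdef]
    · have hjh : h j = true := by simpa [plusMask, hji] using hj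
      simpa [hzdef, hji] using applyMask_eq_iff.mp hagree j hjh
  have hexcl : ∀ h' ∈ excludedSet h i, ζ x' h' = ζ z h' := by
    intro h' hh'
    have hi' : h' i = false := (mem_filter.mp hh').2.1
    refine selector_eq_of_applyMask_eq p ζ hp hζ hnfl hx' hz (applyMask_eq_iff.mpr ?_)
    intro j hj
    have hji : j ≠ i := by
      rintro rfl
      simp [hi'] at hj
    simp [hzdef, hji]
  have hnot : plusMask h i ∉ excludedSet h i := by simp [excludedSet, plusMask]
  rw [hplus, sum_congr rfl hexcl, ← sum_insert hnot, ← hζ.2 z hz]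
  exact sum_le_sum_of_subset_of_nonneg (subset_univ _) fun g _ _ => hζ.1 z g

end Leakage

end
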